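/- Let Δ be a matroid on [s] of dimension s−1−c, let n ≥ c, and let f_1,…,f_s ∈ R = k[x_0,…,x_n] be homogeneous polynomials, all of the same degree d, such that every subset of at most c+1 of them is an R-regular sequence. Then the Waldschmidt constants satisfy α̂(φ_*(I_Δ)) = d · α̂(I_Δ). -/

import Mathlib

/- ------------------------------------------------------------------
   Common definitions
------------------------------------------------------------------ -/

open MvPolynomial CategoryTheory

noncomputable section

/-- The height of an ideal: the infimum of the heights of the prime ideals containing it. -/
noncomputable def idealHeight {A : Type*} [CommRing A] (I : Ideal A) : ℕ∞ :=
  ⨅ P ∈ {P : PrimeSpectrum A | I ≤ P.asIdeal}, Order.height P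

/-- The depth of a module `M` with respect to an ideal `J`: the supremum of the lengths of
`M`-regular sequences consisting of elements of `J`. -/
noncomputable def idealDepth {A : Type*} [CommRing A] (J : Ideal A)
    (M : Type*) [AddCommGroup M] [Module A M] : ℕ∞ :=
  sSup {n : ℕ∞ | ∃ rs : List A, (rs.length : ℕ∞) = n ∧ (∀ r ∈ rs, r ∈ J) ∧
    RingTheory.Sequence.IsRegular M rs}

/-- The irrelevant maximal ideal `(x_i : i ∈ σ)` of the polynomial ring `k[x_i : i ∈ σ]`. -/
def irrelevantIdeal (k : Type) [Field k] (σ : Type) : Ideal (MvPolynomial σ k) :=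
  Ideal.span (Set.range (X : σ → MvPolynomial σ k))

/-- The quotient of a polynomial ring by an ideal `I` is Cohen–Macaulay if its depth with
respect to the irrelevant maximal ideal equals its Krull dimension. -/
def IsCMQuotient {k : Type} [Field k] {σ : Type} (I : Ideal (MvPolynomial σ k)) : Prop :=
  (idealDepth (irrelevantIdeal k σ) (MvPolynomial σ k ⧸ I) : WithBot ℕ∞)
    = ringKrullDim (MvPolynomial σ k ⧸ I)

/-- An ideal of a polynomial ring is homogeneous if it contains all homogeneous components
of each of its elements. -/
def IsHomogeneousIdeal {k : Type} [Field k] {σ : Type} (I : Ideal (MvPolynomial σ k)) : Prop :=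
  ∀ p ∈ I, ∀ i : ℕ, homogeneousComponent i p ∈ I

/-- The Hilbert function of `R/I`, `t ↦ dim_k [R/I]_t`, as a function `ℤ → ℤ`
(equal to `0` in negative degrees). -/
noncomputable def hilbertFn (k : Type) [Field k] {σ : Type} (I : Ideal (MvPolynomial σ k))
    (t : ℤ) : ℤ :=
  if t < 0 then 0
  else
    (Module.finrank k (homogeneousSubmodule σ k t.toNat) : ℤ) -
    (Module.finrank k
      ((Submodule.restrictScalars k (I : Submodule (MvPolynomial σ k) (MvPolynomial σ k))) ⊓
        homogeneousSubmodule σ k t.toNat : Submodule k (MvPolynomial σ k)) : ℤ)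

/-- `P` is the Hilbert polynomial of `R/I` if it agrees with the Hilbert function of `R/I`
in all sufficiently large degrees. -/
def IsHilbertPolyOf (k : Type) [Field k] {σ : Type} (I : Ideal (MvPolynomial σ k))
    (P : Polynomial ℚ) : Prop :=
  ∃ N : ℤ, ∀ t : ℤ, N ≤ t → (hilbertFn k I t : ℚ) = P.eval (t : ℚ)

open Classical in
/-- The Hilbert polynomial of `R/I` (defined as `0` if none exists). -/
noncomputable def hilbertPoly (k : Type) [Field k] {σ : Type} (I : Ideal (MvPolynomial σ k)) :
    Polynomial ℚ :=
  if h : ∃ P : Polynomial ℚ, IsHilbertPolyOf k I P then h.choose else 0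

/-- The multiplicity (degree) `e(R/I)`: `(δ-1)!` times the leading coefficient of the Hilbert
polynomial of `R/I`, whose degree is `δ - 1` where `δ = dim R/I ≥ 1`. -/
noncomputable def multiplicityDeg (k : Type) [Field k] {σ : Type}
    (I : Ideal (MvPolynomial σ k)) : ℚ :=
  (Nat.factorial (hilbertPoly k I).natDegree) * (hilbertPoly k I).leadingCoeff

/-- The `m`-th symbolic power of an ideal `J`:
`J^{(m)} = ⋂_{P ∈ Ass(A/J)} (J^m A_P ∩ A)`. -/
noncomputable def symbolicPower {A : Type*} [CommRing A] (J : Ideal A) (m : ℕ) : Ideal A :=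
  sInf { K : Ideal A | ∃ (P : Ideal A) (hP : IsAssociatedPrime P (A ⧸ J)),
    K = Ideal.comap (algebraMap A (Localization (@Ideal.primeCompl A _ P hP.1)))
          (Ideal.map (algebraMap A (Localization (@Ideal.primeCompl A _ P hP.1))) (J ^ m)) }

/-- `α(I)`: the least degree of a nonzero form in `I`. -/
noncomputable def alphaDeg (k : Type) [Field k] {σ : Type} (I : Ideal (MvPolynomial σ k)) : ℕ :=
  sInf {d : ℕ | ∃ p ∈ I, p ≠ 0 ∧ MvPolynomial.IsHomogeneous p d}

/-- `dim_k Tor_i^A(M, N)`, the rank over the base field `k` of the Tor module. -/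
noncomputable def torRank (k : Type) [Field k] (A : Type) [CommRing A] [Algebra k A]
    (M N : Type) [AddCommGroup M] [Module A M] [AddCommGroup N] [Module A N] (i : ℕ) :
    Cardinal :=
  Module.rank k (RestrictScalars k A
    (((Tor (ModuleCat A) i).obj (ModuleCat.of A M)).obj (ModuleCat.of A N)))

/-- The `i`-th total Betti number `dim_k Tor_i(S/I, k)` of `S/I`, where
`k = S/(x_i : i ∈ σ)`. -/
noncomputable def bettiNum (k : Type) [Field k] {σ : Type} (I : Ideal (MvPolynomial σ k))
    (i : ℕ) : Cardinal :=
  torRank k (MvPolynomial σ k) (MvPolynomial σ k ⧸ I)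
    (MvPolynomial σ k ⧸ irrelevantIdeal k σ) i

/-- The first map `I_S → I_C ⊕ I_S`, `g ↦ (g, f·g)`, of the basic double linkage sequence. -/
def bdlFirstMap {A : Type*} [CommRing A] {I_S I_C : Ideal A} (h : I_S ≤ I_C) (f : A) :
    I_S →ₗ[A] I_C × I_S :=
  LinearMap.prod (Submodule.inclusion h) (f • LinearMap.id)

/-- The second map `I_C ⊕ I_S → f·I_C + I_S`, `(a, b) ↦ f·a - b`, of the basic double
linkage sequence. -/
def bdlSecondMap {A : Type*} [CommRing A] (I_C I_S : Ideal A) (f : A) :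
    I_C × I_S →ₗ[A] ↥(Ideal.span {f} * I_C + I_S) :=
  LinearMap.coprod
    (LinearMap.codRestrict ((Ideal.span {f} * I_C + I_S : Ideal A) : Submodule A A)
      (f • (Submodule.subtype (I_C : Submodule A A)))
      (fun c => Submodule.mem_sup_left
        (Ideal.mul_mem_mul (Ideal.mem_span_singleton_self f) c.2)))
    (- LinearMap.codRestrict ((Ideal.span {f} * I_C + I_S : Ideal A) : Submodule A A)
      (Submodule.subtype (I_S : Submodule A A))
      (fun c => Submodule.mem_sup_right c.2))

/-- The ideal `I_{V_{λ,c}}` of the codimension-`c` configuration determined by `f_1, …, f_s`: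
the intersection of the ideals `(f_{i_1}, …, f_{i_c})` over all `c`-subsets. -/
def configIdeal {A : Type*} [CommRing A] {s : ℕ} (c : ℕ) (f : Fin s → A) : Ideal A :=
  ⨅ T ∈ {T : Finset (Fin s) | T.card = c}, Ideal.span (f '' ↑T)

/-- Every sublist of at most `m` of the elements `f 1, …, f s` (in any order, without
repetitions) is a regular sequence. -/
def SubsetsRegular {A : Type*} [CommRing A] {s : ℕ} (f : Fin s → A) (m : ℕ) : Prop :=
  ∀ l : List (Fin s), l.Nodup → l.length ≤ m →
    RingTheory.Sequence.IsRegular A (l.map f)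

/-- `Δ` is (the independence complex of) a matroid on `{1, …, s}`: a nonempty collection of
subsets closed under inclusion and satisfying the augmentation axiom. -/
def IsMatroid {s : ℕ} (Δ : Finset (Fin s) → Prop) : Prop :=
  Δ ∅ ∧ (∀ F G : Finset (Fin s), Δ F → G ⊆ F → Δ G) ∧
    (∀ F G : Finset (Fin s), Δ F → Δ G → G.card < F.card →
      ∃ j ∈ F, j ∉ G ∧ Δ (insert j G))

/-- `F` is a basis (facet) of the simplicial complex `Δ`: a maximal face. -/
def IsBasisOf {s : ℕ} (Δ : Finset (Fin s) → Prop) (F : Finset (Fin s)) : Prop :=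
  Δ F ∧ ∀ G : Finset (Fin s), Δ G → F ⊆ G → G = F

/-- The Stanley–Reisner ideal of `Δ`, generated by the squarefree monomials corresponding
to the non-faces of `Δ`. -/
def stanleyReisnerIdeal (k : Type) [Field k] {s : ℕ} (Δ : Finset (Fin s) → Prop) :
    Ideal (MvPolynomial (Fin s) k) :=
  Ideal.span
    ((fun F : Finset (Fin s) => ∏ i ∈ F, (X i : MvPolynomial (Fin s) k)) '' {F | ¬ Δ F})

/-- The ideal `I_{W_c}`: the intersection of all ideals `(A_{i_1,j_1}, …, A_{i_c,j_c})`
where `i_1 < ⋯ < i_c` and each generator is chosen from a different group. -/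
def multiPartiteIdeal {A : Type*} [CommRing A] {s : ℕ} (c : ℕ) {e : Fin s → ℕ}
    (g : (i : Fin s) → Fin (e i) → A) : Ideal A :=
  ⨅ T ∈ {T : Finset (Fin s) | T.card = c}, ⨅ j : (i : Fin s) → Fin (e i),
    Ideal.span ((fun i => g i (j i)) '' ↑T)

end

section MatroidConfigurations

variable {ι A : Type*} [CommRing A]

/-- The ideal generated by the elements `f i` with `i ∈ T`. -/
def finsetIdeal (f : ι → A) (T : Finset ι) : Ideal A :=
  Ideal.span (f '' (T : Set ι))

/-- For every `T` with at most `c` elements and every `i ∉ T`, multiplication by `f i` is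
injective modulo the ideal generated by the `f j` with `j ∈ T`. -/
def IsRegularOutside (f : ι → A) (c : ℕ) : Prop :=
  ∀ T : Finset ι, T.card ≤ c → ∀ i ∉ T, ∀ a : A, f i * a ∈ finsetIdeal f T → a ∈ finsetIdeal f T

theorem finsetIdeal_mono (f : ι → A) {S T : Finset ι} (h : S ⊆ T) :
    finsetIdeal f S ≤ finsetIdeal f T :=
  Ideal.span_mono (Set.image_mono (by exact_mod_cast h))

theorem apply_mem_finsetIdeal (f : ι → A) {T : Finset ι} {i : ι} (h : i ∈ T) :
    f i ∈ finsetIdeal f T :=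
  Ideal.subset_span ⟨i, h, rfl⟩

@[simp]
theorem finsetIdeal_empty (f : ι → A) : finsetIdeal f ∅ = ⊥ := by
  simp [finsetIdeal]

theorem finsetIdeal_insert [DecidableEq ι] (f : ι → A) (i : ι) (T : Finset ι) :
    finsetIdeal f (insert i T) = Ideal.span {f i} ⊔ finsetIdeal f T := by
  rw [finsetIdeal, finsetIdeal, Finset.coe_insert, Set.image_insert_eq, Ideal.span_insert]

theorem mem_of_mem_sup_of_le {I K L : Ideal A} {x : A} (hx : x ∈ I ⊔ K) (hI : I ≤ L) (hK : K ≤ L) :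
    x ∈ L :=
  sup_le hI hK hx

theorem mem_sup_of_mem_sup_of_le {I I' K : Ideal A} {x : A} (hx : x ∈ I ⊔ K) (hI : I ≤ I') :
    x ∈ I' ⊔ K :=
  sup_le_sup_right hI K hx

theorem span_singleton_sup_pow_succ_le (x : A) (I : Ideal A) (m : ℕ) :
    (Ideal.span {x} ⊔ I) ^ (m + 1) ≤
      Ideal.span {x} * (Ideal.span {x} ⊔ I) ^ m ⊔ I ^ (m + 1) := by
  induction m with
  | zero => simp
  | succ m ih =>
    calc (Ideal.span {x} ⊔ I) ^ (m + 1 + 1)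
        = Ideal.span {x} * (Ideal.span {x} ⊔ I) ^ (m + 1)
            ⊔ I * (Ideal.span {x} ⊔ I) ^ (m + 1) := by rw [pow_succ', Ideal.sup_mul]
      _ ≤ _ := by
        refine sup_le le_sup_left ?_
        refine (Ideal.mul_mono_right ih).trans ?_
        rw [Ideal.mul_sup]
        refine sup_le (le_sup_of_le_left ?_) (le_sup_of_le_right (pow_succ' I _).ge)
        rw [mul_left_comm, pow_succ']
        exact Ideal.mul_mono_right (Ideal.mul_mono_left le_sup_right)

theorem span_singleton_sup_pow_le (x : A) (I : Ideal A) (m : ℕ) :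
    (Ideal.span {x} ⊔ I) ^ m ≤ Ideal.span {x} ⊔ I ^ m := by
  cases m with
  | zero => simp
  | succ m =>
    exact (span_singleton_sup_pow_succ_le x I m).trans (sup_le_sup_right Ideal.mul_le_left _)

/-- If `x` is a nonzerodivisor modulo all `I ^ m ⊔ K`, then it can be cancelled from
`(x, I) ^ (m + 1) ⊔ K` at the cost of lowering the exponent by one. -/
theorem mem_pow_sup_of_mul_mem_pow_succ_sup {x : A} {I K : Ideal A}
    (hx : ∀ (m : ℕ) (h : A), x * h ∈ I ^ m ⊔ K → h ∈ I ^ m ⊔ K) (m : ℕ) {h : A}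
    (hh : x * h ∈ (Ideal.span {x} ⊔ I) ^ (m + 1) ⊔ K) :
    h ∈ (Ideal.span {x} ⊔ I) ^ m ⊔ K := by
  have h₁ := sup_le_sup_right (span_singleton_sup_pow_succ_le x I m) K hh
  rw [sup_assoc] at h₁
  obtain ⟨p, hp, q, hq, hpq⟩ := Submodule.mem_sup.mp h₁
  obtain ⟨b, hb, rfl⟩ := Ideal.mem_span_singleton_mul.mp hp
  have h₂ : h - b ∈ I ^ (m + 1) ⊔ K := by
    refine hx _ _ ?_
    rwa [mul_sub, ← hpq, add_sub_cancel_left]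
  have h₃ : I ^ (m + 1) ≤ (Ideal.span {x} ⊔ I) ^ m :=
    (Ideal.pow_le_pow_right m.le_succ).trans (Ideal.pow_right_mono le_sup_right m)
  rw [← sub_add_cancel h b]
  exact add_mem (sup_le_sup_right h₃ K h₂) (Submodule.mem_sup_left hb)

variable [DecidableEq ι]

/-- A set `Q` of elements without common annihilator modulo `(f i : i ∈ S ∪ T)` has none modulo
`(f i : i ∈ T) ^ m + (f i : i ∈ S)`. -/
theorem IsRegularOutside.mem_of_forall_mul_mem {f : ι → A} {c : ℕ} (hf : IsRegularOutside f c)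
    (T : Finset ι) : ∀ (S : Finset ι) (m : ℕ) (Q : Set A), Disjoint S T → S.card + T.card ≤ c →
      (∀ h, (∀ y ∈ Q, y * h ∈ finsetIdeal f (S ∪ T)) → h ∈ finsetIdeal f (S ∪ T)) →
      ∀ h, (∀ y ∈ Q, y * h ∈ finsetIdeal f T ^ m ⊔ finsetIdeal f S) →
        h ∈ finsetIdeal f T ^ m ⊔ finsetIdeal f S := by
  induction T using Finset.induction_on with
  | empty =>
    intro S m Q _ _ hQ h hh
    cases m with
    | zero => simp
    | succ m =>
      have h₀ : (⊥ : Ideal A) ^ (m + 1) = ⊥ := by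
        rw [← Ideal.zero_eq_bot, zero_pow m.succ_ne_zero]
      simp only [finsetIdeal_empty, h₀, bot_sup_eq, Finset.union_empty] at hQ hh ⊢
      exact hQ h hh
  | insert x T hxT ih =>
    intro S m Q hST hcard hQ
    obtain ⟨hxS, hST'⟩ := Finset.disjoint_insert_right.mp hST
    rw [Finset.card_insert_of_notMem hxT] at hcard
    have hunion : insert x S ∪ T = S ∪ insert x T := by
      rw [Finset.insert_union, Finset.union_insert]
    have hx : ∀ (m : ℕ) (h : A), f x * h ∈ finsetIdeal f T ^ m ⊔ finsetIdeal f S →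
        h ∈ finsetIdeal f T ^ m ⊔ finsetIdeal f S := by
      intro m h hh
      refine ih S m {f x} hST' (by omega) (fun a ha => ?_) h (by simpa using hh)
      exact hf _ ((Finset.card_union_le _ _).trans (by omega)) x (by simp [hxS, hxT]) a
        (ha _ rfl)
    induction m with
    | zero => simp
    | succ m ihm =>
      intro h hh
      have h₁ : h ∈ finsetIdeal f T ^ (m + 1) ⊔ finsetIdeal f (insert x S) := by
        refine ih (insert x S) (m + 1) Q ?_ ?_ (by rwa [hunion]) h fun y hy => ?_
        · exact Finset.disjoint_insert_left.mpr ⟨hxT, hST'⟩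
        · rw [Finset.card_insert_of_notMem hxS]; omega
        · have := hh y hy
          rw [finsetIdeal_insert] at this ⊢
          refine mem_of_mem_sup_of_le this ((span_singleton_sup_pow_le _ _ _).trans ?_) ?_
          · exact sup_le (le_sup_of_le_right le_sup_left) le_sup_left
          · exact le_sup_of_le_right le_sup_right
      rw [finsetIdeal_insert, sup_left_comm] at h₁
      obtain ⟨p, hp, a, ha, rfl⟩ := Submodule.mem_sup.mp h₁
      obtain ⟨b, rfl⟩ := Ideal.mem_span_singleton'.mp hp
      have ha' : a ∈ finsetIdeal f (insert x T) ^ (m + 1) ⊔ finsetIdeal f S :=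
        sup_le_sup_right
          (Ideal.pow_right_mono (finsetIdeal_mono f (Finset.subset_insert x T)) _) _ ha
      have hb : b ∈ finsetIdeal f (insert x T) ^ m ⊔ finsetIdeal f S := by
        refine ihm b fun y hy => ?_
        rw [finsetIdeal_insert]
        refine mem_pow_sup_of_mul_mem_pow_succ_sup hx m ?_
        rw [← finsetIdeal_insert]
        have := sub_mem (hh y hy) (Ideal.mul_mem_left _ y ha')
        rwa [← mul_sub, add_sub_cancel_right, ← mul_assoc, mul_comm _ (f x)] at this
      refine add_mem ?_ ha'
      obtain ⟨b₁, hb₁, b₂, hb₂, rfl⟩ := Submodule.mem_sup.mp hb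
      rw [add_mul]
      refine add_mem (Submodule.mem_sup_left ?_)
        (Submodule.mem_sup_right (Ideal.mul_mem_right _ _ hb₂))
      rw [pow_succ]
      exact Ideal.mul_mem_mul hb₁ (apply_mem_finsetIdeal f (Finset.mem_insert_self x T))

theorem IsRegularOutside.mem_of_mul_mem {f : ι → A} {c : ℕ} (hf : IsRegularOutside f c)
    {S T : Finset ι} (hST : Disjoint S T) (hcard : S.card + T.card ≤ c) {i : ι} (hiS : i ∉ S)
    (hiT : i ∉ T) (m : ℕ) {h : A} (hh : f i * h ∈ finsetIdeal f T ^ m ⊔ finsetIdeal f S) :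
    h ∈ finsetIdeal f T ^ m ⊔ finsetIdeal f S := by
  refine hf.mem_of_forall_mul_mem T S m {f i} hST hcard (fun a ha => ?_) h (by simpa using hh)
  exact hf _ ((Finset.card_union_le _ _).trans hcard) i (by simp [hiS, hiT]) a (ha _ rfl)

theorem IsRegularOutside.mem_pow_pred_of_mul_mem {f : ι → A} {c : ℕ} (hf : IsRegularOutside f c)
    {S T : Finset ι} (hST : Disjoint S T) (hcard : S.card + T.card ≤ c) {i : ι} (hiT : i ∈ T)
    (m : ℕ) {h : A} (hh : f i * h ∈ finsetIdeal f T ^ m ⊔ finsetIdeal f S) :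
    h ∈ finsetIdeal f T ^ (m - 1) ⊔ finsetIdeal f S := by
  cases m with
  | zero => simp
  | succ m =>
    have hins := Finset.insert_erase hiT
    rw [← hins, finsetIdeal_insert] at hh ⊢
    refine mem_pow_sup_of_mul_mem_pow_succ_sup (fun n a ha => ?_) m hh
    have := Finset.card_erase_of_mem hiT
    exact hf.mem_of_mul_mem (hST.mono_right (Finset.erase_subset i T)) (by omega)
      (Finset.disjoint_right.mp hST hiT) (Finset.notMem_erase i T) n ha

variable [Fintype ι]

theorem prod_pow_mem_finsetIdeal_pow (f : ι → A) (v : ι → ℕ) (T : Finset ι) :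
    ∏ i, f i ^ v i ∈ finsetIdeal f T ^ ∑ i ∈ T, v i := by
  rw [← Finset.prod_mul_prod_compl T, ← Finset.prod_pow_eq_pow_sum]
  exact Ideal.mul_mem_right _ _ (Ideal.prod_mem_prod fun i hi =>
    Ideal.pow_mem_pow (apply_mem_finsetIdeal f hi) _)

/-- The ideal generated by the products `∏ i, f i ^ v i` for exponents `v` of weight at least `m`
on every member of `𝓑`. -/
def weightIdeal (f : ι → A) (𝓑 : Set (Finset ι)) (m : ℕ) : Ideal A :=
  Ideal.span ((fun v : ι → ℕ => ∏ i, f i ^ v i) '' {v | ∀ B ∈ 𝓑, m ≤ ∑ i ∈ B, v i})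

/-- The exchange property of the bases of a matroid of rank `c`. -/
structure IsExchangeFamily (𝓑 : Set (Finset ι)) (c : ℕ) : Prop where
  card_eq : ∀ B ∈ 𝓑, B.card = c
  exchange : ∀ B ∈ 𝓑, ∀ B' ∈ 𝓑, ∀ i ∈ B', i ∉ B → ∃ j ∈ B, j ∉ B' ∧ insert i (B.erase j) ∈ 𝓑

/-- The relative form of `iInf_finsetIdeal_pow_eq_weightIdeal`, in which the members of `S` have
been contracted and the exponents are shifted by a weight `u`. -/
theorem IsExchangeFamily.mem_span_sup {f : ι → A} {c : ℕ} (hf : IsRegularOutside f c)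
    {𝓑 : Set (Finset ι)} (h𝓑 : IsExchangeFamily 𝓑 c) (m : ℕ) (r : ℕ) :
    ∀ (S : Finset ι) (u : ι → ℕ) (g : A), S.card + r = c →
      (∀ B ∈ 𝓑, S ⊆ B → g ∈ finsetIdeal f (B \ S) ^ (m - ∑ i ∈ B, u i) ⊔ finsetIdeal f S) →
      g ∈ Ideal.span ((fun v : ι → ℕ => ∏ i, f i ^ v i) ''
        {v | (∀ i ∈ S, v i = 0) ∧ ∀ B ∈ 𝓑, S ⊆ B → m ≤ ∑ i ∈ B, (v i + u i)})
          ⊔ finsetIdeal f S := by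
  have htriv : ∀ (S : Finset ι) (u : ι → ℕ) (g : A),
      (∀ B ∈ 𝓑, S ⊆ B → m ≤ ∑ i ∈ B, u i) →
      g ∈ Ideal.span ((fun v : ι → ℕ => ∏ i, f i ^ v i) ''
        {v | (∀ i ∈ S, v i = 0) ∧ ∀ B ∈ 𝓑, S ⊆ B → m ≤ ∑ i ∈ B, (v i + u i)})
          ⊔ finsetIdeal f S := by
    intro S u g hu
    refine Submodule.mem_sup_left ?_
    rw [← mul_one g]
    refine Ideal.mul_mem_left _ g (Ideal.subset_span ⟨0, ⟨fun _ _ => rfl, ?_⟩, by simp⟩)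
    simpa using hu
  induction r with
  | zero =>
    intro S u g hS hg
    by_cases hu : ∀ B ∈ 𝓑, S ⊆ B → m ≤ ∑ i ∈ B, u i
    · exact htriv S u g hu
    · push Not at hu
      obtain ⟨B, hB, hSB, hlt⟩ := hu
      have hBS : B = S :=
        (Finset.eq_of_subset_of_card_le hSB (by rw [h𝓑.card_eq B hB]; omega)).symm
      have := hg B hB hSB
      rw [hBS, Finset.sdiff_self, finsetIdeal_empty, ← Ideal.zero_eq_bot,
        zero_pow (by rw [← hBS]; omega), Ideal.zero_eq_bot, bot_sup_eq] at this
      exact Submodule.mem_sup_right this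
  | succ r ih =>
    intro S u
    induction hN : ∑ i, (m - u i) using Nat.strong_induction_on generalizing u with
    | _ N ihN =>
    subst hN
    intro g hS hg
    by_cases hu : ∀ B ∈ 𝓑, S ⊆ B → m ≤ ∑ i ∈ B, u i
    · exact htriv S u g hu
    have hout : ∀ B ∈ 𝓑, ∃ j ∈ B, j ∉ S := fun B hB =>
      Finset.exists_mem_notMem_of_card_lt_card (by rw [h𝓑.card_eq B hB]; omega)
    obtain ⟨i, ⟨hiS, B₀, hB₀, hSB₀⟩, hmin⟩ : ∃ i ∈ {i | i ∉ S ∧ ∃ B ∈ 𝓑, insert i S ⊆ B},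
        ∀ j ∈ {i | i ∉ S ∧ ∃ B ∈ 𝓑, insert i S ⊆ B}, u i ≤ u j := by
      refine Set.exists_min_image _ u (Set.toFinite _) ?_
      push Not at hu
      obtain ⟨B, hB, hSB, _⟩ := hu
      obtain ⟨j, hjB, hjS⟩ := hout B hB
      exact ⟨j, hjS, B, hB, Finset.insert_subset hjB hSB⟩
    have hmin' : ∀ B ∈ 𝓑, S ⊆ B → ∀ j ∈ B, j ∉ S → u i ≤ u j := fun B hB hSB j hjB hjS =>
      hmin j ⟨hjS, B, hB, Finset.insert_subset hjB hSB⟩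
    have hum : u i < m := by
      by_contra hum
      refine hu fun B hB hSB => ?_
      obtain ⟨j, hjB, hjS⟩ := hout B hB
      exact (not_lt.mp hum).trans ((hmin' B hB hSB j hjB hjS).trans
        (Finset.single_le_sum (f := u) (fun _ _ => Nat.zero_le _) hjB))
    have hcontr := ih (insert i S) u g (by rw [Finset.card_insert_of_notMem hiS]; omega) (by
      intro B hB hB'
      obtain ⟨hiB, hSB⟩ := Finset.insert_subset_iff.mp hB'
      have h₁ := hg B hB hSB
      have h₂ : B \ S = insert i (B \ insert i S) := by
        ext j; by_cases hj : j = i <;> simp [hj, hiB, hiS]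
      rw [h₂, finsetIdeal_insert] at h₁
      rw [finsetIdeal_insert]
      refine mem_of_mem_sup_of_le h₁ ((span_singleton_sup_pow_le _ _ _).trans ?_) ?_
      · exact sup_le (le_sup_of_le_right le_sup_left) le_sup_left
      · exact le_sup_of_le_right le_sup_right)
    rw [finsetIdeal_insert, sup_left_comm] at hcontr
    obtain ⟨p, hp, q, hq, rfl⟩ := Submodule.mem_sup.mp hcontr
    obtain ⟨h, rfl⟩ := Ideal.mem_span_singleton.mp hp
    have hq' : q ∈ Ideal.span ((fun v : ι → ℕ => ∏ i, f i ^ v i) ''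
        {v | (∀ i ∈ S, v i = 0) ∧ ∀ B ∈ 𝓑, S ⊆ B → m ≤ ∑ i ∈ B, (v i + u i)})
          ⊔ finsetIdeal f S := by
      refine mem_sup_of_mem_sup_of_le hq (Ideal.span_mono (Set.image_mono ?_))
      rintro v ⟨hvS, hv⟩
      refine ⟨fun j hj => hvS j (Finset.mem_insert_of_mem hj), fun B hB hSB => ?_⟩
      by_cases hiB : i ∈ B
      · exact hv B hB (Finset.insert_subset hiB hSB)
      obtain ⟨j, hjB, hjB₀, hB'⟩ := h𝓑.exchange B hB B₀ hB₀ i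
        (hSB₀ (Finset.mem_insert_self i S)) hiB
      have hjS : j ∉ S := fun hj => hjB₀ (hSB₀ (Finset.mem_insert_of_mem hj))
      have h₁ := hv _ hB' (Finset.insert_subset_insert i (Finset.subset_erase.mpr ⟨hSB, hjS⟩))
      rw [Finset.sum_insert (by simp [hiB]), hvS i (Finset.mem_insert_self i S)] at h₁
      have h₂ := hmin' B hB hSB j hjB hjS
      have h₃ := Finset.add_sum_erase B (fun l => v l + u l) hjB
      omega
    have hsum : ∀ B : Finset ι, ∑ j ∈ B, (u + Pi.single i 1 : ι → ℕ) j =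
        ∑ j ∈ B, u j + if i ∈ B then 1 else 0 := by
      intro B
      simp only [Pi.add_apply, Finset.sum_add_distrib, Finset.sum_pi_single']
    have hh : h ∈ Ideal.span ((fun v : ι → ℕ => ∏ i, f i ^ v i) ''
        {v | (∀ j ∈ S, v j = 0) ∧ ∀ B ∈ 𝓑, S ⊆ B →
          m ≤ ∑ j ∈ B, (v j + (u + Pi.single i 1 : ι → ℕ) j)}) ⊔ finsetIdeal f S := by
      refine ihN _ ?_ (u + Pi.single i 1) rfl h hS fun B hB hSB => ?_
      · refine Finset.sum_lt_sum (fun j _ => ?_) ⟨i, Finset.mem_univ i, ?_⟩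
        · simp only [Pi.add_apply]; omega
        · simp only [Pi.add_apply, Pi.single_eq_same]; omega
      · have hqB : q ∈ finsetIdeal f (B \ S) ^ (m - ∑ i ∈ B, u i) ⊔ finsetIdeal f S := by
          refine mem_sup_of_mem_sup_of_le hq' (Ideal.span_le.mpr ?_)
          rintro _ ⟨v, ⟨hvS, hv⟩, rfl⟩
          refine Ideal.pow_le_pow_right ?_ (prod_pow_mem_finsetIdeal_pow f v (B \ S))
          have h₁ := hv B hB hSB
          have h₂ := Finset.sum_sdiff (f := v) hSB
          rw [Finset.sum_eq_zero hvS] at h₂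
          rw [Finset.sum_add_distrib] at h₁
          omega
        have hfh : f i * h ∈ finsetIdeal f (B \ S) ^ (m - ∑ i ∈ B, u i) ⊔ finsetIdeal f S := by
          simpa using sub_mem (hg B hB hSB) hqB
        have hdisj : Disjoint S (B \ S) := Finset.disjoint_sdiff
        have hcard : S.card + (B \ S).card ≤ c := by
          rw [Finset.card_sdiff_of_subset hSB, h𝓑.card_eq B hB]; omega
        rw [hsum]
        by_cases hiB : i ∈ B
        · rw [if_pos hiB, ← Nat.sub_sub]
          exact hf.mem_pow_pred_of_mul_mem hdisj hcard (Finset.mem_sdiff.mpr ⟨hiB, hiS⟩) _ hfh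
        · rw [if_neg hiB, add_zero]
          exact hf.mem_of_mul_mem hdisj hcard hiS (fun hi => hiB (Finset.mem_sdiff.mp hi).1) _ hfh
    refine add_mem ?_ hq'
    obtain ⟨a, ha, b, hb, rfl⟩ := Submodule.mem_sup.mp hh
    rw [mul_add]
    refine add_mem (Submodule.mem_sup_left ?_)
      (Submodule.mem_sup_right (Ideal.mul_mem_left _ _ hb))
    have := Ideal.mul_mem_mul (Ideal.mem_span_singleton_self (f i)) ha
    rw [Ideal.span_mul_span'] at this
    refine Ideal.span_mono ?_ this
    rintro _ ⟨_, rfl, _, ⟨v, ⟨hvS, hv⟩, rfl⟩, rfl⟩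
    refine ⟨v + Pi.single i 1, ⟨fun j hj => ?_, fun B hB hSB => ?_⟩, ?_⟩
    · have : j ≠ i := fun h => hiS (h ▸ hj)
      simp [hvS j hj, this]
    · refine (hv B hB hSB).trans_eq (Finset.sum_congr rfl fun j _ => ?_)
      simp only [Pi.add_apply]; omega
    · have : ∏ j, f j ^ (Pi.single i 1 : ι → ℕ) j = f i := by
        rw [Finset.prod_eq_single i (fun j _ hj => by simp [hj]) (by simp)]
        simp
      simp only [Pi.add_apply, pow_add, Finset.prod_mul_distrib, this, mul_comm]

/-- The intersection of the `m`-th powers of the ideals of a matroid configuration is generated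
by products of the `f i`. -/
theorem iInf_finsetIdeal_pow_eq_weightIdeal {f : ι → A} {c : ℕ} (hf : IsRegularOutside f c)
    {𝓑 : Set (Finset ι)} (h𝓑 : IsExchangeFamily 𝓑 c) (m : ℕ) :
    ⨅ B ∈ 𝓑, finsetIdeal f B ^ m = weightIdeal f 𝓑 m := by
  apply le_antisymm
  · intro g hg
    simp only [Ideal.mem_iInf] at hg
    simpa [weightIdeal] using h𝓑.mem_span_sup hf m c ∅ 0 g (by simp) (by simpa using hg)
  · refine Ideal.span_le.mpr ?_
    rintro _ ⟨v, hv, rfl⟩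
    simp only [SetLike.mem_coe, Ideal.mem_iInf]
    exact fun B hB => Ideal.pow_le_pow_right (hv B hB) (prod_pow_mem_finsetIdeal_pow f v B)

theorem isAssociatedPrime_quotient_iff [IsNoetherianRing A] {I P : Ideal A} :
    IsAssociatedPrime P (A ⧸ I) ↔ P.IsPrime ∧ ∃ x : A, ∀ p, p ∈ P ↔ p * x ∈ I := by
  have key : ∀ x p : A, p ∈ (⊥ : Submodule A (A ⧸ I)).colon {Ideal.Quotient.mk I x} ↔
      p * x ∈ I := fun x p => by
    rw [Submodule.mem_colon_singleton, Submodule.mem_bot, ← Ideal.Quotient.eq_zero_iff_mem,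
      map_mul, Algebra.smul_def, Ideal.Quotient.algebraMap_eq]
  rw [isAssociatedPrime_iff]
  refine and_congr_right fun _ => ⟨?_, ?_⟩
  · rintro ⟨y, rfl⟩
    obtain ⟨x, rfl⟩ := Ideal.Quotient.mk_surjective y
    exact ⟨x, key x⟩
  · rintro ⟨x, hx⟩
    exact ⟨Ideal.Quotient.mk I x, Ideal.ext fun p => (hx p).trans (key x p).symm⟩

theorem mem_symbolicPower_iff {J : Ideal A} {m : ℕ} {g : A} :
    g ∈ symbolicPower J m ↔
      ∀ P : Ideal A, IsAssociatedPrime P (A ⧸ J) → ∃ t ∉ P, t * g ∈ J ^ m := by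
  have key : ∀ (P : Ideal A) (hP : P.IsPrime),
      g ∈ Ideal.comap (algebraMap A (Localization P.primeCompl))
        (Ideal.map (algebraMap A (Localization P.primeCompl)) (J ^ m)) ↔
          ∃ t ∉ P, t * g ∈ J ^ m := fun P hP => by
    rw [Ideal.mem_comap, IsLocalization.algebraMap_mem_map_algebraMap_iff P.primeCompl]
    rfl
  simp only [symbolicPower, Submodule.mem_sInf, Set.mem_ofPred_eq]
  constructor
  · intro h P hP
    exact (key P hP.1).mp (h _ ⟨P, hP, rfl⟩)
  · rintro h _ ⟨P, hP, rfl⟩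
    exact (key P hP.1).mpr (h P hP)

theorem IsExchangeFamily.prod_compl_mul_mem {𝓑 : Set (Finset ι)} {c : ℕ}
    (h𝓑 : IsExchangeFamily 𝓑 c) (f : ι → A) {B : Finset ι} (hB : B ∈ 𝓑) {a : A}
    (ha : a ∈ finsetIdeal f B) : (∏ j ∈ Bᶜ, f j) * a ∈ weightIdeal f 𝓑 1 := by
  induction ha using Submodule.span_induction with
  | zero => simp
  | add x y _ _ hx hy => rw [mul_add]; exact add_mem hx hy
  | smul b x _ hx => rw [smul_eq_mul, mul_left_comm]; exact Ideal.mul_mem_left _ b hx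
  | mem x hx =>
    obtain ⟨i, hi, rfl⟩ := hx
    refine Ideal.subset_span ⟨fun j => if j ∈ insert i Bᶜ then 1 else 0, fun B' hB' => ?_, ?_⟩
    · obtain ⟨j, hj, hj'⟩ : ∃ j ∈ B', j ∉ B.erase i :=
        Finset.exists_mem_notMem_of_card_lt_card (by
          rw [h𝓑.card_eq B' hB', ← h𝓑.card_eq B hB]; exact Finset.card_erase_lt_of_mem hi)
      refine le_trans ?_ (Finset.single_le_sum
        (f := fun j => if j ∈ insert i Bᶜ then 1 else 0) (fun _ _ => Nat.zero_le _) hj)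
      rw [if_pos]
      rw [Finset.mem_insert, Finset.mem_compl]
      by_contra! hcon
      exact hj' (Finset.mem_erase.mpr hcon)
    · have hi' : i ∉ Bᶜ := fun h => Finset.mem_compl.mp h hi
      simp only [pow_ite, pow_one, pow_zero]
      rw [Finset.prod_ite_mem, Finset.univ_inter, Finset.prod_insert hi', mul_comm]

/-- The symbolic powers of the ideal of a matroid configuration are the intersections of the
ordinary powers of the complete intersections it consists of. -/
theorem symbolicPower_weightIdeal_one [IsNoetherianRing A] {f : ι → A} {c : ℕ}
    (hf : IsRegularOutside f c) {𝓑 : Set (Finset ι)} (h𝓑 : IsExchangeFamily 𝓑 c) (m : ℕ) :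
    symbolicPower (weightIdeal f 𝓑 1) m = weightIdeal f 𝓑 m := by
  have hJ : ∀ a, a ∈ weightIdeal f 𝓑 1 ↔ ∀ B ∈ 𝓑, a ∈ finsetIdeal f B := fun a => by
    simp [← iInf_finsetIdeal_pow_eq_weightIdeal hf h𝓑]
  have hcompl : ∀ B ∈ 𝓑, ∀ x, (∏ j ∈ Bᶜ, f j) * x ∈ finsetIdeal f B → x ∈ finsetIdeal f B := by
    intro B hB x
    have : ∀ T : Finset ι, Disjoint T B →
        (∏ j ∈ T, f j) * x ∈ finsetIdeal f B → x ∈ finsetIdeal f B := by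
      intro T
      induction T using Finset.induction_on with
      | empty => simp
      | insert j T hj ih =>
        intro hd hx
        obtain ⟨hjB, hTB⟩ := Finset.disjoint_insert_left.mp hd
        rw [Finset.prod_insert hj, mul_assoc] at hx
        exact ih hTB (hf B (h𝓑.card_eq B hB).le j hjB _ hx)
    exact this Bᶜ disjoint_compl_left
  rw [← iInf_finsetIdeal_pow_eq_weightIdeal hf h𝓑 m]
  ext g
  rw [mem_symbolicPower_iff]
  simp only [Submodule.mem_iInf]
  constructor
  · intro hg B hB
    by_contra hgB
    obtain ⟨h, hh, hhB⟩ : ∃ h, (∀ y ∈ {y | y * g ∈ finsetIdeal f B ^ m}, y * h ∈ finsetIdeal f B) ∧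
        h ∉ finsetIdeal f B := by
      by_contra! hcon
      have := hf.mem_of_forall_mul_mem B ∅ m {y | y * g ∈ finsetIdeal f B ^ m}
        (Finset.disjoint_empty_left B) (by simp [h𝓑.card_eq B hB]) (by simpa using hcon) g
        (by simp)
      exact hgB (by simpa using this)
    obtain ⟨P, hP, hhP⟩ := exists_le_isAssociatedPrime_of_isNoetherianRing A
      (Ideal.Quotient.mk (finsetIdeal f B) h) (by rwa [Ne, Ideal.Quotient.eq_zero_iff_mem])
    have hP' : IsAssociatedPrime P (A ⧸ weightIdeal f 𝓑 1) := by
      rw [isAssociatedPrime_quotient_iff] at hP ⊢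
      obtain ⟨hprime, x, hx⟩ := hP
      refine ⟨hprime, (∏ j ∈ Bᶜ, f j) * x, fun p => ⟨fun hp => ?_, fun hp => (hx p).mpr ?_⟩⟩
      · rw [mul_left_comm]
        exact h𝓑.prod_compl_mul_mem f hB ((hx p).mp hp)
      · rw [mul_left_comm] at hp
        exact hcompl B hB _ ((hJ _).mp hp B hB)
    obtain ⟨t, htP, ht⟩ := hg P hP'
    refine htP (hhP ?_)
    rw [Submodule.mem_colon_singleton, Submodule.mem_bot, Algebra.smul_def,
      Ideal.Quotient.algebraMap_eq, ← map_mul, Ideal.Quotient.eq_zero_iff_mem]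
    exact hh t (Ideal.pow_right_mono (fun a ha => (hJ a).mp ha B hB) m ht)
  · intro hg P hP
    obtain ⟨hprime, x, hx⟩ := isAssociatedPrime_quotient_iff.mp hP
    obtain ⟨B, hB, hBP⟩ : ∃ B ∈ 𝓑, ∀ p, p * x ∈ finsetIdeal f B → p ∈ P := by
      by_contra! hcon
      choose! p hp hpP using hcon
      have : ∏ B ∈ 𝓑.toFinite.toFinset, p B ∈ P := by
        rw [hx, hJ]
        intro B hB
        rw [← Finset.mul_prod_erase _ _ (𝓑.toFinite.mem_toFinset.mpr hB), mul_right_comm]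
        exact Ideal.mul_mem_right _ _ (hp B hB)
      obtain ⟨B, hB, hBP⟩ := (Ideal.IsPrime.prod_mem_iff).mp this
      exact hpP B (𝓑.toFinite.mem_toFinset.mp hB) hBP
    have htP : ∏ j ∈ Bᶜ, f j ∉ P := by
      intro ht
      have h₁ := hcompl B hB x ((hJ _).mp ((hx _).mp ht) B hB)
      exact hprime.ne_top ((Ideal.eq_top_iff_one P).mpr (hBP 1 (by rwa [one_mul])))
    refine ⟨(∏ j ∈ Bᶜ, f j) ^ m, fun h => htP (hprime.mem_of_pow_mem m h), ?_⟩
    have h₁ : Ideal.span {∏ j ∈ Bᶜ, f j} * finsetIdeal f B ≤ weightIdeal f 𝓑 1 :=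
      Ideal.span_singleton_mul_le_iff.mpr fun a ha => h𝓑.prod_compl_mul_mem f hB ha
    refine Ideal.pow_right_mono h₁ m ?_
    rw [mul_pow]
    exact Ideal.mul_mem_mul (Ideal.pow_mem_pow (Ideal.mem_span_singleton_self _) m) (hg B hB)

end MatroidConfigurations

section Degrees

variable {ι σ : Type} {k : Type} [Field k]

theorem SubsetsRegular.isRegularOutside {A : Type*} [CommRing A] {s c : ℕ} {f : Fin s → A}
    (hf : SubsetsRegular f (c + 1)) : IsRegularOutside f c := by
  intro T hT i hi a ha
  have hreg := (hf (T.toList ++ [i]) (by simp [List.nodup_append, T.nodup_toList]; grind)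
    (by simpa using hT)).toIsWeaklyRegular
  have hofList : Ideal.ofList (T.toList.map f) = finsetIdeal f T := by
    simp only [Ideal.ofList, finsetIdeal, List.mem_map, Finset.mem_toList]
    rfl
  have htake : ((T.toList ++ [i]).map f).take T.card = T.toList.map f := by
    rw [List.map_append, List.take_left' (by simp)]
  have h₁ := hreg.regular_mod_prev T.card (by simp)
  rw [htake, hofList, isSMulRegular_quotient_iff_mem_of_smul_mem] at h₁
  simpa using h₁ a (by simpa using ha)

theorem isRegularOutside_X (c : ℕ) : IsRegularOutside (X : ι → MvPolynomial ι k) c := by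
  intro T _ i hi a ha
  rw [finsetIdeal, mem_ideal_span_X_image] at ha ⊢
  intro v hv
  obtain ⟨j, hj, hj'⟩ := ha (Finsupp.single i 1 + v) (by
    rw [mem_support_iff, coeff_X_mul]; exact mem_support_iff.mp hv)
  refine ⟨j, hj, ?_⟩
  have : i ≠ j := fun h => hi (h ▸ hj)
  simpa [Finsupp.single_apply, this] using hj'

variable [Fintype ι]

theorem isHomogeneous_prod_pow {d : ℕ} {f : ι → MvPolynomial σ k}
    (hdeg : ∀ i, (f i).IsHomogeneous d) (v : ι → ℕ) :
    (∏ i, f i ^ v i).IsHomogeneous (d * ∑ i, v i) := by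
  rw [Finset.mul_sum]
  exact IsHomogeneous.prod _ _ _ fun i _ => (hdeg i).pow (v i)

/-- The initial degree of an ideal generated by products of forms of degree `d`. -/
theorem alphaDeg_weightIdeal {d : ℕ} {f : ι → MvPolynomial σ k}
    (hdeg : ∀ i, (f i).IsHomogeneous d) (hne : ∀ i, f i ≠ 0) (𝓑 : Set (Finset ι)) (m : ℕ) :
    alphaDeg k (weightIdeal f 𝓑 m) =
      d * sInf ((fun v : ι → ℕ => ∑ i, v i) '' {v | ∀ B ∈ 𝓑, m ≤ ∑ i ∈ B, v i}) := by
  set V := {v : ι → ℕ | ∀ B ∈ 𝓑, m ≤ ∑ i ∈ B, v i} with hV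
  rcases V.eq_empty_or_nonempty with hempty | hnonempty
  · simp only [alphaDeg, weightIdeal, ← hV, hempty]
    simp
  obtain ⟨v, hv, hvmin⟩ := Nat.sInf_mem (hnonempty.image fun v : ι → ℕ => ∑ i, v i)
  rw [← hvmin]
  have hmem : d * ∑ i, v i ∈ {e : ℕ | ∃ p ∈ weightIdeal f 𝓑 m, p ≠ 0 ∧ p.IsHomogeneous e} :=
    ⟨_, Ideal.subset_span ⟨v, hv, rfl⟩,
      Finset.prod_ne_zero_iff.mpr fun i _ => pow_ne_zero _ (hne i), isHomogeneous_prod_pow hdeg v⟩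
  refine le_antisymm (Nat.sInf_le hmem) (le_csInf ⟨_, hmem⟩ ?_)
  rintro e ⟨p, hp, hp0, hpe⟩
  have hle : weightIdeal f 𝓑 m ≤ idealOfVars σ k ^ (d * ∑ i, v i) := by
    refine Ideal.span_le.mpr ?_
    rintro _ ⟨w, hw, rfl⟩
    rw [SetLike.mem_coe, mem_pow_idealOfVars_iff]
    intro x hx
    have h₁ := isHomogeneous_prod_pow hdeg w (mem_support_iff.mp hx)
    rw [Pi.one_def, ← Finsupp.degree_eq_weight_one] at h₁
    rw [h₁]
    exact Nat.mul_le_mul_left d (hvmin.trans_le (Nat.sInf_le ⟨w, hw, rfl⟩))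
  obtain ⟨x, hx⟩ := Finset.nonempty_iff_ne_empty.mpr (mt support_eq_empty.mp hp0)
  have h₁ := hpe (mem_support_iff.mp hx)
  rw [Pi.one_def, ← Finsupp.degree_eq_weight_one] at h₁
  rw [← h₁]
  exact (mem_pow_idealOfVars_iff _ p).mp (hle hp) x hx

end Degrees

section Matroids

variable {s c : ℕ} {Δ : Finset (Fin s) → Prop}

theorem exists_isBasisOf {F : Finset (Fin s)} (hF : Δ F) :
    ∃ G, F ⊆ G ∧ IsBasisOf Δ G := by
  obtain ⟨G, hFG, hG⟩ := (Set.toFinite {G | Δ G}).exists_le_maximal hF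
  exact ⟨G, hFG, hG.1, fun H hH hGH => (hG.eq_of_le hH hGH).symm⟩

theorem IsMatroid.isExchangeFamily (hmat : IsMatroid Δ) (hcs : c ≤ s)
    (hdim : ∀ F, IsBasisOf Δ F → F.card = s - c) :
    IsExchangeFamily {B | IsBasisOf Δ Bᶜ} c where
  card_eq B hB := by
    have h₁ := hdim _ hB
    have h₂ := Finset.card_le_univ B
    rw [Finset.card_compl] at h₁
    simp only [Fintype.card_fin] at h₁ h₂
    omega
  exchange := by
    intro B hB B' hB' i hi hiB
    have hiB' : i ∈ Bᶜ := Finset.mem_compl.mpr hiB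
    have hcard := Finset.card_erase_lt_of_mem hiB'
    rw [hdim _ hB, ← hdim _ hB'] at hcard
    obtain ⟨j, hj, hjB, hjΔ⟩ := hmat.2.2 B'ᶜ (Bᶜ.erase i) hB'.1
      (hmat.2.1 _ _ hB.1 (Finset.erase_subset _ _)) hcard
    have hji : j ≠ i := fun h => Finset.mem_compl.mp hj (h ▸ hi)
    have hjB' : j ∈ B := by simpa [hji] using hjB
    refine ⟨j, hjB', Finset.mem_compl.mp hj, ?_⟩
    have hcompl : (insert i (B.erase j))ᶜ = insert j (Bᶜ.erase i) := by
      ext l; by_cases hl : l = j <;> simp [hl, hji]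
    rw [Set.mem_ofPred_eq, hcompl]
    obtain ⟨G, hFG, hG⟩ := exists_isBasisOf hjΔ
    rwa [Finset.eq_of_subset_of_card_le hFG]
    rw [hdim G hG, Finset.card_insert_of_notMem hjB, Finset.card_erase_of_mem hiB', hdim _ hB]
    omega

theorem IsMatroid.map_stanleyReisnerIdeal {k A : Type} [Field k] [CommRing A] [Algebra k A]
    (hmat : IsMatroid Δ) (f : Fin s → A) :
    Ideal.map (MvPolynomial.aeval (R := k) f).toRingHom (stanleyReisnerIdeal k Δ) =
      weightIdeal f {B | IsBasisOf Δ Bᶜ} 1 := by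
  rw [stanleyReisnerIdeal, Ideal.map_span]
  apply le_antisymm
  · refine Ideal.span_le.mpr ?_
    rintro _ ⟨_, ⟨F, hF, rfl⟩, rfl⟩
    refine Ideal.subset_span ⟨fun j => if j ∈ F then 1 else 0, fun B hB => ?_, ?_⟩
    · obtain ⟨j, hjF, hjB⟩ : ∃ j ∈ F, j ∉ Bᶜ :=
        Finset.not_subset.mp fun h => hF (hmat.2.1 _ _ hB.1 h)
      refine le_trans (by simp [hjF]) (Finset.single_le_sum
        (f := fun j => if j ∈ F then 1 else 0) (fun _ _ => Nat.zero_le _)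
        (Finset.notMem_compl.mp hjB))
    · simp [pow_ite, Finset.prod_ite_mem]
  · refine Ideal.span_le.mpr ?_
    rintro _ ⟨v, hv, rfl⟩
    have hF : ¬ Δ {i | v i ≠ 0} := fun hF => by
      obtain ⟨G, hFG, hG⟩ := exists_isBasisOf hF
      have h₁ := hv Gᶜ (by rwa [Set.mem_ofPred_eq, compl_compl])
      rw [Finset.sum_eq_zero] at h₁
      · omega
      · intro i hi
        by_contra hvi
        exact Finset.mem_compl.mp hi (hFG (by simpa using hvi))
    refine Ideal.mem_of_dvd _ ?_ (Ideal.subset_span ⟨_, ⟨_, hF, rfl⟩, rfl⟩)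
    simp only [AlgHom.toRingHom_eq_coe, RingHom.coe_coe, map_prod, aeval_X]
    refine (Finset.prod_dvd_prod_of_dvd _ _ fun i hi => ?_).trans
      (Finset.prod_dvd_prod_of_subset _ _ (fun i => f i ^ v i) (Finset.subset_univ _))
    exact dvd_pow_self _ (by simpa using hi)

end Matroids

theorem statement18 (k : Type) [Field k] [Infinite k] (s c n : ℕ) (hcs : c ≤ s) (hcn : c ≤ n)
    (Δ : Finset (Fin s) → Prop) (hmat : IsMatroid Δ)
    (hdim : ∀ F, IsBasisOf Δ F → F.card = s - c)
    (d : ℕ) (f : Fin s → MvPolynomial (Fin (n + 1)) k)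
    (hdeg : ∀ i, (f i).IsHomogeneous d)
    (hreg : SubsetsRegular f (c + 1)) :
    ∀ a : ℝ,
      Filter.Tendsto (fun m : ℕ =>
          (alphaDeg k (⨅ F ∈ {F : Finset (Fin s) | IsBasisOf Δ F},
            (Ideal.span ((X : Fin s → MvPolynomial (Fin s) k) '' ↑(Fᶜ))) ^ m) : ℝ) / m)
        Filter.atTop (nhds a) →
      Filter.Tendsto (fun m : ℕ =>
          (alphaDeg k (symbolicPower (Ideal.map (MvPolynomial.aeval (R := k) f).toRingHom
            (stanleyReisnerIdeal k Δ)) m) : ℝ) / m)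
        Filter.atTop (nhds ((d : ℝ) * a)) := by
  intro a ha
  have hexch := hmat.isExchangeFamily hcs hdim
  have hf := hreg.isRegularOutside
  have hne : ∀ i, f i ≠ 0 := fun i hi => by
    have := hf ∅ (by simp) i (by simp) 1 (by simp [hi])
    simp at this
  have hα : ∀ m, alphaDeg k (symbolicPower (Ideal.map (MvPolynomial.aeval (R := k) f).toRingHom
      (stanleyReisnerIdeal k Δ)) m) =
      d * alphaDeg k (⨅ F ∈ {F : Finset (Fin s) | IsBasisOf Δ F},
        (Ideal.span ((X : Fin s → MvPolynomial (Fin s) k) '' ↑(Fᶜ))) ^ m) := by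
    intro m
    have hinf : ⨅ F ∈ {F : Finset (Fin s) | IsBasisOf Δ F},
        (Ideal.span ((X : Fin s → MvPolynomial (Fin s) k) '' ↑(Fᶜ))) ^ m =
        ⨅ B ∈ {B : Finset (Fin s) | IsBasisOf Δ Bᶜ},
          finsetIdeal (X : Fin s → MvPolynomial (Fin s) k) B ^ m := by
      refine Equiv.iInf_congr (Equiv.ofBijective _ compl_bijective) fun F => ?_
      simp [finsetIdeal]
    rw [hmat.map_stanleyReisnerIdeal, symbolicPower_weightIdeal_one hf hexch,
      alphaDeg_weightIdeal hdeg hne, hinf,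
      iInf_finsetIdeal_pow_eq_weightIdeal (isRegularOutside_X c) hexch,
      alphaDeg_weightIdeal (fun i => isHomogeneous_X k i) (fun i => X_ne_zero i), one_mul]
  simp only [hα, Nat.cast_mul, mul_div_assoc]
  exact ha.const_mul (d : ℝ)
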